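/- The orbit of the 4-dimensional nilpotent Jordan algebra 𝔄_{4,63} is not distinguished: let μ ∈ 𝒥_4 be defined on the standard basis n_1, n_2, n_3, n_4 of ℂ⁴ by μ(n_1,n_2) = μ(n_2,n_1) = n_3, μ(n_1,n_3) = μ(n_3,n_1) = n_4, μ(n_2,n_2) = n_4, and all other products of basis vectors zero. Then no element of the orbit GL(4,ℂ)·μ is a soliton. -/

import Mathlib

open Matrix

noncomputable section

/-- `Vn n` is the space of `n`-dimensional commutative complex algebras, i.e. symmetric
ℂ-bilinear maps `ℂⁿ × ℂⁿ → ℂⁿ`, encoded by structure constants with respect to the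
standard basis: `μ i j k` is the `e k`-coordinate of `μ(e i, e j)`. -/
abbrev Vn (n : ℕ) : Type := Fin n → Fin n → Fin n → ℂ

namespace Vn

variable {n : ℕ}

/-- symmetry (commutativity) of the multiplication -/
def IsSymm (μ : Vn n) : Prop := ∀ i j k, μ i j k = μ j i k

/-- the product `μ(x, y)` -/
def mul (μ : Vn n) (x y : Fin n → ℂ) : Fin n → ℂ :=
  fun k => ∑ i, ∑ j, x i * y j * μ i j k

/-- left multiplication `L^μ_x`, as a matrix -/
def L (μ : Vn n) (x : Fin n → ℂ) : Matrix (Fin n) (Fin n) ℂ :=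
  Matrix.of fun k j => ∑ i, x i * μ i j k

/-- the standard Hermitian inner product on `ℂⁿ` (linear in the first variable) -/
def herm (x y : Fin n → ℂ) : ℂ := ∑ i, x i * star (y i)

/-- the moment matrix `M_μ = -2 ∑ᵢ (L_{xᵢ})* L_{xᵢ} + ∑ᵢ L_{xᵢ} (L_{xᵢ})*`,
computed with respect to the standard orthonormal basis of `ℂⁿ` -/
def Mmat (μ : Vn n) : Matrix (Fin n) (Fin n) ℂ :=
  (-2 : ℂ) • ∑ i, (L μ (Pi.single i 1))ᴴ * L μ (Pi.single i 1)
    + ∑ i, L μ (Pi.single i 1) * (L μ (Pi.single i 1))ᴴ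

/-- the Hermitian product on `Vn n` -/
def innerV (μ ν : Vn n) : ℂ := ∑ i, ∑ j, ∑ k, μ i j k * star (ν i j k)

/-- the squared norm `‖μ‖²` on `Vn n` -/
def normSqV (μ : Vn n) : ℝ := ∑ i, ∑ j, ∑ k, Complex.normSq (μ i j k)

/-- the infinitesimal change-of-basis action of `gl(n, ℂ)` on `Vn n`:
`(A·μ)(x,y) = A(μ(x,y)) - μ(Ax,y) - μ(x,Ay)` -/
def glAct (A : Matrix (Fin n) (Fin n) ℂ) (μ : Vn n) : Vn n :=
  fun i j k =>
    (A *ᵥ mul μ (Pi.single i 1) (Pi.single j 1)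
      - mul μ (A *ᵥ Pi.single i 1) (Pi.single j 1)
      - mul μ (Pi.single i 1) (A *ᵥ Pi.single j 1)) k

/-- the change-of-basis action of `GL(n, ℂ)` on `Vn n`:
`(g·μ)(x,y) = g(μ(g⁻¹x, g⁻¹y))` -/
def gAct (g : GL (Fin n) ℂ) (μ : Vn n) : Vn n :=
  fun i j k =>
    ((g : Matrix (Fin n) (Fin n) ℂ) *ᵥ
      mul μ ((↑g⁻¹ : Matrix (Fin n) (Fin n) ℂ) *ᵥ Pi.single i 1)
            ((↑g⁻¹ : Matrix (Fin n) (Fin n) ℂ) *ᵥ Pi.single j 1)) k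

/-- the `GL(n,ℂ)`-orbit (isomorphism class) of `μ` -/
def orbit (μ : Vn n) : Set (Vn n) := { ν | ∃ g : GL (Fin n) ℂ, ν = gAct g μ }

/-- `D` is a derivation of `μ` -/
def IsDeriv (μ : Vn n) (D : Matrix (Fin n) (Fin n) ℂ) : Prop :=
  ∀ x y, D *ᵥ mul μ x y = mul μ (D *ᵥ x) y + mul μ x (D *ᵥ y)

/-- the associator `(a,b,c) = (ab)c - a(bc)` -/
def assoc (μ : Vn n) (a b c : Fin n → ℂ) : Fin n → ℂ :=
  mul μ (mul μ a b) c - mul μ a (mul μ b c)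

/-- `μ` is a Jordan algebra: commutative and satisfying the linearized Jordan identity
`(ab,c,d) + (bd,c,a) + (da,c,b) = 0` -/
def IsJordan (μ : Vn n) : Prop :=
  IsSymm μ ∧ ∀ a b c d : Fin n → ℂ,
    assoc μ (mul μ a b) c d + assoc μ (mul μ b d) c a + assoc μ (mul μ d a) c b = 0

/-- `μ` is a soliton: `μ ≠ 0` and `M_μ · μ ∈ ℝ μ` -/
def IsSoliton (μ : Vn n) : Prop :=
  μ ≠ 0 ∧ ∃ c : ℝ, glAct (Mmat μ) μ = (c : ℂ) • μ

/-- the constant `c_μ = -Tr(M_μ²)/‖μ‖²` -/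
def cconst (μ : Vn n) : ℝ := -(Matrix.trace (Mmat μ * Mmat μ)).re / normSqV μ

/-- `D_μ = M_μ - c_μ • I` -/
def Dmat (μ : Vn n) : Matrix (Fin n) (Fin n) ℂ := Mmat μ - (cconst μ : ℂ) • 1

/-- the energy `E_n(μ) = Tr(M_μ²)/‖μ‖⁴` -/
def energy (μ : Vn n) : ℝ := (Matrix.trace (Mmat μ * Mmat μ)).re / (normSqV μ) ^ 2

/-- the trace form `τ_μ(x, y) = Tr L_{μ(x,y)}` -/
def traceForm (μ : Vn n) (x y : Fin n → ℂ) : ℂ := Matrix.trace (L μ (mul μ x y))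

/-- nondegeneracy of the trace form (Albert's criterion for semisimplicity) -/
def TraceFormNondeg (μ : Vn n) : Prop := ∀ x, (∀ y, traceForm μ x y = 0) → x = 0

end Vn


/-- the nilpotent Jordan algebra `𝔄_{4,63}`: `n₁n₂ = n₃`, `n₁n₃ = n₄`, `n₂² = n₄`
(with `n₁,…,n₄` the standard basis, indexed `0,…,3`). -/
def mu463 : Vn 4 := fun i j k =>
  if (i = 0 ∧ j = 1 ∧ k = 2) ∨ (i = 1 ∧ j = 0 ∧ k = 2)
    ∨ (i = 0 ∧ j = 2 ∧ k = 3) ∨ (i = 2 ∧ j = 0 ∧ k = 3)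
    ∨ (i = 1 ∧ j = 1 ∧ k = 3) then 1 else 0

namespace Vn

variable {n : ℕ}

/-- The product of `μ`, bundled as a bilinear map. -/
def mulₗ (μ : Vn n) : (Fin n → ℂ) →ₗ[ℂ] (Fin n → ℂ) →ₗ[ℂ] (Fin n → ℂ) :=
  LinearMap.mk₂ ℂ (mul μ)
    (fun x y z => by
      ext k; simp [mul, add_mul, Finset.sum_add_distrib])
    (fun c x y => by
      ext k; simp [mul, Finset.mul_sum, mul_assoc])
    (fun x y z => by
      ext k; simp [mul, mul_add, add_mul, Finset.sum_add_distrib])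
    (fun c x y => by
      ext k
      simp only [mul, Finset.mul_sum, Pi.smul_apply, smul_eq_mul]
      exact Finset.sum_congr rfl fun i _ => Finset.sum_congr rfl fun j _ => by ring)

@[simp]
lemma mulₗ_apply (μ : Vn n) (x y : Fin n → ℂ) : mulₗ μ x y = mul μ x y := rfl

@[simp]
lemma mul_single (μ : Vn n) (i j : Fin n) :
    mul μ (Pi.single i 1) (Pi.single j 1) = μ i j := by
  ext k
  simp [mul, Pi.single_apply]

lemma mulₗ_ext {B C : (Fin n → ℂ) →ₗ[ℂ] (Fin n → ℂ) →ₗ[ℂ] (Fin n → ℂ)}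
    (h : ∀ i j, B (Pi.single i 1) (Pi.single j 1) = C (Pi.single i 1) (Pi.single j 1)) :
    B = C := by
  refine (Pi.basisFun ℂ (Fin n)).ext fun i => (Pi.basisFun ℂ (Fin n)).ext fun j => ?_
  simpa using h i j

lemma mul_gAct (g : GL (Fin n) ℂ) (μ : Vn n) (x y : Fin n → ℂ) :
    mul (gAct g μ) x y = (g : Matrix (Fin n) (Fin n) ℂ) *ᵥ
      mul μ ((↑g⁻¹ : Matrix (Fin n) (Fin n) ℂ) *ᵥ x) ((↑g⁻¹ : Matrix (Fin n) (Fin n) ℂ) *ᵥ y) := by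
  have h : mulₗ (gAct g μ) =
      ((mulₗ μ).compl₁₂ (Matrix.mulVecLin (↑g⁻¹ : Matrix (Fin n) (Fin n) ℂ))
        (Matrix.mulVecLin (↑g⁻¹ : Matrix (Fin n) (Fin n) ℂ))).compr₂
        (Matrix.mulVecLin (g : Matrix (Fin n) (Fin n) ℂ)) := by
    refine mulₗ_ext fun i j => ?_
    simp only [mulₗ_apply, mul_single, LinearMap.compr₂_apply, LinearMap.compl₁₂_apply,
      Matrix.mulVecLin_apply]
    rfl
  simpa using congr($h x y)

lemma mul_glAct (A : Matrix (Fin n) (Fin n) ℂ) (μ : Vn n) (x y : Fin n → ℂ) :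
    mul (glAct A μ) x y = A *ᵥ mul μ x y - mul μ (A *ᵥ x) y - mul μ x (A *ᵥ y) := by
  have h : mulₗ (glAct A μ) = (mulₗ μ).compr₂ (Matrix.mulVecLin A)
      - (mulₗ μ).compl₁₂ (Matrix.mulVecLin A) LinearMap.id
      - (mulₗ μ).compl₁₂ LinearMap.id (Matrix.mulVecLin A) := by
    refine mulₗ_ext fun i j => ?_
    simp only [mulₗ_apply, mul_single, LinearMap.compr₂_apply, LinearMap.compl₁₂_apply,
      LinearMap.sub_apply, Matrix.mulVecLin_apply, LinearMap.id_apply]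
    ext k
    simp [glAct]
  simpa using congr($h x y)

lemma gAct_mul (g h : GL (Fin n) ℂ) (μ : Vn n) : gAct (g * h) μ = gAct g (gAct h μ) := by
  funext i j k
  simp only [gAct, mul_gAct, Matrix.mulVec_mulVec, ← Units.val_mul, ← _root_.mul_inv_rev]

lemma gAct_smul (g : GL (Fin n) ℂ) (c : ℂ) (μ : Vn n) : gAct g (c • μ) = c • gAct g μ := by
  have h (x y : Fin n → ℂ) : mul (c • μ) x y = c • mul μ x y := by
    ext k
    simp only [mul, Pi.smul_apply, smul_eq_mul, Finset.mul_sum]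
    exact Finset.sum_congr rfl fun i _ => Finset.sum_congr rfl fun j _ => by ring
  funext i j k
  simp only [gAct, h, Matrix.mulVec_smul, Pi.smul_apply]

lemma glAct_conj_gAct (g : GL (Fin n) ℂ) (A : Matrix (Fin n) (Fin n) ℂ) (μ : Vn n) :
    glAct ((g : Matrix (Fin n) (Fin n) ℂ) * A * (↑g⁻¹ : Matrix (Fin n) (Fin n) ℂ)) (gAct g μ) =
      gAct g (glAct A μ) := by
  have hg : (↑g⁻¹ : Matrix (Fin n) (Fin n) ℂ) * (g : Matrix (Fin n) (Fin n) ℂ) = 1 := by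
    rw [← Units.val_mul]; simp
  have hg' (B : Matrix (Fin n) (Fin n) ℂ) :
      (↑g⁻¹ : Matrix (Fin n) (Fin n) ℂ) * ((g : Matrix (Fin n) (Fin n) ℂ) * B) = B := by
    rw [← Matrix.mul_assoc, hg, Matrix.one_mul]
  funext i j k
  simp only [glAct, gAct]
  simp only [mul_gAct, mul_glAct, Matrix.mulVec_mulVec, Matrix.mulVec_sub, hg',
    Matrix.mul_assoc, hg, Matrix.mul_one]

lemma L_mulVec (μ : Vn n) (x y : Fin n → ℂ) : L μ x *ᵥ y = mul μ x y := by
  ext k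
  simp only [L, mul, Matrix.mulVec, dotProduct, Matrix.of_apply, Finset.sum_mul]
  rw [Finset.sum_comm]
  exact Finset.sum_congr rfl fun i _ => Finset.sum_congr rfl fun j _ => by ring

lemma L_gAct (g : GL (Fin n) ℂ) (μ : Vn n) (x : Fin n → ℂ) :
    L (gAct g μ) x = (g : Matrix (Fin n) (Fin n) ℂ) *
      L μ ((↑g⁻¹ : Matrix (Fin n) (Fin n) ℂ) *ᵥ x) * (↑g⁻¹ : Matrix (Fin n) (Fin n) ℂ) := by
  refine Matrix.toLin'.injective (LinearMap.ext fun y => ?_)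
  simp only [Matrix.toLin'_apply, ← Matrix.mulVec_mulVec, L_mulVec, mul_gAct]

lemma L_mulVec_single (μ : Vn n) (A : Matrix (Fin n) (Fin n) ℂ) (i : Fin n) :
    L μ (A *ᵥ Pi.single i 1) = ∑ p, A p i • L μ (Pi.single p 1) := by
  ext k j
  simp [L, Matrix.sum_apply, Pi.single_apply]

lemma sum_unitary_smul_conj_smul {R : Type*} [Ring R] [Algebra ℂ R]
    {A : Matrix (Fin n) (Fin n) ℂ} (hA : A * Aᴴ = 1) (F G : Fin n → R) :
    ∑ i, (∑ p, A p i • F p) * (∑ p, star (A p i) • G p) = ∑ p, F p * G p := by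
  have h (p q : Fin n) : ∑ i, A p i * star (A q i) = if p = q then 1 else 0 := by
    rw [← Matrix.one_apply, ← hA]
    simp [Matrix.mul_apply]
  simp only [Finset.sum_mul_sum, smul_mul_smul_comm]
  rw [Finset.sum_comm]
  refine Finset.sum_congr rfl fun p _ => ?_
  rw [Finset.sum_comm]
  simp only [← Finset.sum_smul, h]
  simp

lemma Mmat_gAct_of_unitary (g : GL (Fin n) ℂ)
    (hg : (↑g⁻¹ : Matrix (Fin n) (Fin n) ℂ) = (g : Matrix (Fin n) (Fin n) ℂ)ᴴ) (μ : Vn n) :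
    Mmat (gAct g μ) =
      (g : Matrix (Fin n) (Fin n) ℂ) * Mmat μ * (↑g⁻¹ : Matrix (Fin n) (Fin n) ℂ) := by
  set U : Matrix (Fin n) (Fin n) ℂ := (g : Matrix (Fin n) (Fin n) ℂ)
  have hU : Uᴴ * U = 1 := by rw [← hg, ← Units.val_mul]; simp
  have hU' : Uᴴ * Uᴴᴴ = 1 := by rw [conjTranspose_conjTranspose, hU]
  have hL (i : Fin n) : L (gAct g μ) (Pi.single i 1) =
      U * (∑ p, Uᴴ p i • L μ (Pi.single p 1)) * Uᴴ := by
    rw [L_gAct, hg, L_mulVec_single]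
  have h1 (A : Matrix (Fin n) (Fin n) ℂ) : (U * A * Uᴴ)ᴴ * (U * A * Uᴴ) = U * (Aᴴ * A) * Uᴴ := by
    simp only [conjTranspose_mul, conjTranspose_conjTranspose, Matrix.mul_assoc]
    rw [← Matrix.mul_assoc Uᴴ U, hU, Matrix.one_mul]
  have h2 (A : Matrix (Fin n) (Fin n) ℂ) : (U * A * Uᴴ) * (U * A * Uᴴ)ᴴ = U * (A * Aᴴ) * Uᴴ := by
    simp only [conjTranspose_mul, conjTranspose_conjTranspose, Matrix.mul_assoc]
    rw [← Matrix.mul_assoc Uᴴ U, hU, Matrix.one_mul]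
  have hr := sum_unitary_smul_conj_smul hU' (fun p => L μ (Pi.single p 1))
    (fun p => (L μ (Pi.single p 1))ᴴ)
  have hl := sum_unitary_smul_conj_smul (A := Uᴴ.map star) (by
      ext i j
      have := congr(star ($hU' i j))
      simpa [Matrix.mul_apply, Matrix.one_apply, apply_ite] using this)
    (fun p => (L μ (Pi.single p 1))ᴴ) (fun p => L μ (Pi.single p 1))
  simp only [Matrix.map_apply, star_star] at hl
  simp only [Mmat, hL, h1, h2, hg, ← Finset.mul_sum, ← Finset.sum_mul, conjTranspose_sum,
    conjTranspose_smul, hr, hl]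
  simp [Matrix.mul_add, Matrix.add_mul]

lemma IsSoliton.exists_gAct_of_unitary {μ : Vn n} (h : IsSoliton μ) (g : GL (Fin n) ℂ)
    (hg : (↑g⁻¹ : Matrix (Fin n) (Fin n) ℂ) = (g : Matrix (Fin n) (Fin n) ℂ)ᴴ) :
    ∃ c : ℝ, glAct (Mmat (gAct g μ)) (gAct g μ) = (c : ℂ) • gAct g μ := by
  obtain ⟨-, c, hc⟩ := h
  exact ⟨c, by rw [Mmat_gAct_of_unitary g hg, glAct_conj_gAct, hc, gAct_smul]⟩

/-- A `QL`-type decomposition: every invertible matrix becomes lower triangular after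
multiplication on the left by a suitable unitary matrix. -/
lemma exists_unitary_mul_lowerTriangular (g : GL (Fin n) ℂ) :
    ∃ k : GL (Fin n) ℂ,
      (↑k⁻¹ : Matrix (Fin n) (Fin n) ℂ) = (k : Matrix (Fin n) (Fin n) ℂ)ᴴ ∧
      ∀ i j, i < j → (↑(k * g) : Matrix (Fin n) (Fin n) ℂ) i j = 0 := by
  let f : (Fin n)ᵒᵈ → EuclideanSpace ℂ (Fin n) :=
    fun i => WithLp.toLp 2 fun l => (g : Matrix (Fin n) (Fin n) ℂ) l (OrderDual.ofDual i)
  have hcard : Module.finrank ℂ (EuclideanSpace ℂ (Fin n)) = Fintype.card (Fin n)ᵒᵈ := by simp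
  let u := InnerProductSpace.gramSchmidtOrthonormalBasis hcard f
  let v : OrthonormalBasis (Fin n) ℂ (EuclideanSpace ℂ (Fin n)) := u.reindex OrderDual.ofDual
  let K : Matrix (Fin n) (Fin n) ℂ :=
    v.toBasis.toMatrix (EuclideanSpace.basisFun (Fin n) ℂ).toBasis
  have hK : K ∈ Matrix.unitaryGroup (Fin n) ℂ :=
    v.toMatrix_orthonormalBasis_mem_unitary (EuclideanSpace.basisFun (Fin n) ℂ)
  have h1 : K * Kᴴ = 1 := Matrix.mem_unitaryGroup_iff.1 hK
  have h2 : Kᴴ * K = 1 := Matrix.mem_unitaryGroup_iff'.1 hK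
  refine ⟨⟨K, Kᴴ, h1, h2⟩, rfl, fun i j hij => ?_⟩
  have h := InnerProductSpace.gramSchmidtOrthonormalBasis_inv_triangular' hcard f
    (i := OrderDual.toDual j) (j := OrderDual.toDual i) (by simpa using hij)
  have hf : f (OrderDual.toDual j) = ∑ l, (g : Matrix (Fin n) (Fin n) ℂ) l j •
      EuclideanSpace.basisFun (Fin n) ℂ l := by
    ext m
    simp [f, Pi.single_apply]
  rw [hf] at h
  simp only [map_sum, map_smul] at h
  simpa [Matrix.mul_apply, K, v, u, Module.Basis.toMatrix_apply, mul_comm] using h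

lemma glAct_apply (A : Matrix (Fin n) (Fin n) ℂ) (μ : Vn n) (i j k : Fin n) :
    glAct A μ i j k = ∑ l, A k l * μ i j l - ∑ p, A p i * μ p j k - ∑ p, A p j * μ i p k := by
  simp [glAct, mul, Matrix.mulVec, dotProduct, Pi.single_apply]

lemma Mmat_apply (μ : Vn n) (a b : Fin n) :
    Mmat μ a b = -2 * ∑ i, ∑ k, star (μ i a k) * μ i b k
      + ∑ i, ∑ j, μ i j a * star (μ i j b) := by
  simp [Mmat, L, Matrix.sum_apply, Matrix.mul_apply, Pi.single_apply]

lemma Mmat_isHermitian (μ : Vn n) : (Mmat μ).IsHermitian := by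
  ext a b
  simp [Mmat_apply, mul_comm]


/-- A strictly filtered algebra on `ℂ⁴` which is a filtered deformation of `𝔄_{4,63}` does not
satisfy the soliton equation. -/
lemma glAct_Mmat_ne_smul_of_filtered {ν : Vn 4} (hs : IsSymm ν)
    (hz : ∀ i j k : Fin 4, (k : ℕ) < i + j + 1 → ν i j k = 0) (h001 : ν 0 0 1 = 0)
    (hb : ν 0 1 2 ≠ 0) (hc : ν 0 2 3 ≠ 0) (hd : ν 1 1 3 ≠ 0) (t : ℝ) :
    glAct (Mmat ν) ν ≠ (t : ℂ) • ν := by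
  intro h
  have hMh (i j : Fin 4) : Mmat ν j i = star (Mmat ν i j) :=
    ((Mmat_isHermitian ν).apply j i).symm
  have hMd (i : Fin 4) := Mmat_apply ν i i
  have E (i j k : Fin 4) : ∑ l, Mmat ν k l * ν i j l - ∑ p, Mmat ν p i * ν p j k
      - ∑ p, Mmat ν p j * ν i p k = t * ν i j k := by
    rw [← glAct_apply, h]; rfl
  clear h
  generalize Mmat ν = M at hMh hMd E
  have hz' (i j k : Fin 4) (hk : (k : ℕ) < i + j + 1 := by decide) : ν i j k = 0 := hz i j k hk
  simp only [Fin.sum_univ_four] at E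
  have s10 (k) : ν 1 0 k = ν 0 1 k := hs _ _ _
  have s20 (k) : ν 2 0 k = ν 0 2 k := hs _ _ _
  have z00 : ν 0 0 0 = 0 := hz' _ _ _
  have z010 : ν 0 1 0 = 0 := hz' _ _ _
  have z011 : ν 0 1 1 = 0 := hz' _ _ _
  have z020 : ν 0 2 0 = 0 := hz' _ _ _
  have z021 : ν 0 2 1 = 0 := hz' _ _ _
  have z022 : ν 0 2 2 = 0 := hz' _ _ _
  have z110 : ν 1 1 0 = 0 := hz' _ _ _
  have z111 : ν 1 1 1 = 0 := hz' _ _ _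
  have z112 : ν 1 1 2 = 0 := hz' _ _ _
  have z03 (k) : ν 0 3 k = 0 := hz _ _ _ (by simp)
  have z30 (k) : ν 3 0 k = 0 := hz _ _ _ (by simp)
  have z12 (k) : ν 1 2 k = 0 := hz _ _ _ (by simp)
  have z21 (k) : ν 2 1 k = 0 := hz _ _ _ (by simp)
  have z13 (k) : ν 1 3 k = 0 := hz _ _ _ (by simp; omega)
  have z31 (k) : ν 3 1 k = 0 := hz _ _ _ (by simp; omega)
  have z22 (k) : ν 2 2 k = 0 := hz _ _ _ (by simp; omega)
  have z23 (k) : ν 2 3 k = 0 := hz _ _ _ (by simp; omega)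
  have z32 (k) : ν 3 2 k = 0 := hz _ _ _ (by simp; omega)
  have z33 (k) : ν 3 3 k = 0 := hz _ _ _ (by simp; omega)
  have e020 := E 0 2 0
  have e021 := E 0 2 1
  have e223 := E 2 2 3
  have e011 := E 0 1 1
  have e123 := E 1 2 3
  have e112 := E 1 1 2
  have e012 := E 0 1 2
  have e023 := E 0 2 3
  have e113 := E 1 1 3
  have e002 := E 0 0 2
  have e003 := E 0 0 3
  have e013 := E 0 1 3
  have d0 := hMd 0
  have d1 := hMd 1
  have d2 := hMd 2
  have d3 := hMd 3
  simp only [Fin.sum_univ_four, Complex.star_def, mul_comm ((starRingEnd ℂ) _), Complex.mul_conj,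
    s10, s20, z00, h001, z010, z011, z020, z021, z022, z110, z111, z112, z03, z30, z12, z21, z13,
    z31, z22, z23, z32, z33, map_zero, Complex.ofReal_zero, mul_zero, add_zero, zero_add,
    sub_zero, zero_sub, neg_mul]
    at e020 e021 e223 e011 e123 e112 e012 e023 e113 e002 e003 e013 d0 d1 d2 d3
  have m03 : M 0 3 = 0 := mul_right_cancel₀ hc (by linear_combination e020)
  have m13 : M 1 3 = 0 := mul_right_cancel₀ hc (by linear_combination e021)
  have m02 : M 0 2 = 0 := mul_right_cancel₀ hc (by linear_combination -e223 / 2)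
  have m12 : M 1 2 = 0 :=
    mul_right_cancel₀ hb (by linear_combination e011 - ν 0 1 3 * m13)
  have m01 : M 0 1 = 0 :=
    mul_right_cancel₀ hc (by linear_combination -e123 - ν 0 1 3 * m02 - ν 1 1 3 * m12)
  have m23 : M 2 3 = 0 :=
    mul_right_cancel₀ hd (by linear_combination e112 + 2 * ν 0 1 2 * m01)
  have m10 : M 1 0 = 0 := by rw [hMh, m01, star_zero]
  have m20 : M 2 0 = 0 := by rw [hMh, m02, star_zero]
  have m21 : M 2 1 = 0 := by rw [hMh, m12, star_zero]
  have m32 : M 3 2 = 0 := by rw [hMh, m23, star_zero]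
  simp only [m01, m02, m12, m23, m10, m20, m21, m32, zero_mul, add_zero, zero_add]
    at e012 e023 e113 e002 e003 e013
  have pb := Complex.normSq_pos.2 hb
  have pc := Complex.normSq_pos.2 hc
  have pd := Complex.normSq_pos.2 hd
  have f012 : M 2 2 - M 0 0 - M 1 1 = t := mul_right_cancel₀ hb (by linear_combination e012)
  have f023 : M 3 3 - M 0 0 - M 2 2 = t := mul_right_cancel₀ hc (by linear_combination e023)
  have f113 : M 3 3 - 2 * M 1 1 = t := mul_right_cancel₀ hd (by linear_combination e113)
  have hs : M 0 0 + t ≠ 0 := by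
    intro hs
    have h03 : M 0 0 = M 3 3 := by linear_combination -3 * hs - 2 * f012 - 2 * f023 + f113
    rw [d0, d3] at h03
    norm_cast at h03
    have := Complex.normSq_nonneg (ν 0 0 2)
    have := Complex.normSq_nonneg (ν 0 0 3)
    have := Complex.normSq_nonneg (ν 0 1 3)
    linarith
  have p0 : ν 0 0 2 = 0 := (mul_eq_zero.1 (by
    linear_combination e002 + ν 0 0 2 * (-2 * f012 - f023 + f113))).resolve_left hs
  have q0 : ν 0 0 3 = 0 := (mul_eq_zero.1 (by
    linear_combination (e003 + ν 0 0 3 * (-2 * f012 - 2 * f023 + f113)) / 2)).resolve_left hs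
  have r0 : ν 0 1 3 = 0 := (mul_eq_zero.1 (by
    linear_combination e013 + ν 0 1 3 * (-f012 - f023))).resolve_left hs
  simp only [p0, q0, r0, map_zero, Complex.ofReal_zero, add_zero, zero_add] at d0 d1 d2 d3
  have g1 : M 0 0 + M 2 2 = 2 * M 1 1 := by linear_combination f113 - f023
  have g2 : M 1 1 + M 3 3 = 2 * M 2 2 := by linear_combination f023 - f012
  rw [d0, d1, d2] at g1
  rw [d1, d2, d3] at g2
  norm_cast at g1 g2
  linarith

lemma gAct_mu463_filtered {g : GL (Fin 4) ℂ}
    (hg : ∀ i j, i < j → (g : Matrix (Fin 4) (Fin 4) ℂ) i j = 0) :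
    IsSymm (gAct g mu463) ∧
    (∀ i j k : Fin 4, (k : ℕ) < i + j + 1 → gAct g mu463 i j k = 0) ∧
    gAct g mu463 0 0 1 = 0 ∧ gAct g mu463 0 1 2 ≠ 0 ∧ gAct g mu463 0 2 3 ≠ 0 ∧
    gAct g mu463 1 1 3 ≠ 0 := by
  set G : Matrix (Fin 4) (Fin 4) ℂ := (g : Matrix (Fin 4) (Fin 4) ℂ) with hG
  set H : Matrix (Fin 4) (Fin 4) ℂ := (↑g⁻¹ : Matrix (Fin 4) (Fin 4) ℂ) with hH
  have hGH : G * H = 1 := by rw [hG, hH, ← Units.val_mul]; simp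
  have hHl (i j : Fin 4) (hij : i < j) : H i j = 0 := by
    have : H = G⁻¹ := (Matrix.inv_eq_right_inv hGH).symm
    have := invertibleOfRightInverse G H hGH
    have hG' : G.BlockTriangular OrderDual.toDual := fun i j hij => hg i j hij
    rw [‹H = G⁻¹›]
    exact Matrix.blockTriangular_inv_of_blockTriangular hG' hij
  have key (i j k : Fin 4) : gAct g mu463 i j k =
      G k 2 * (H 0 i * H 1 j + H 1 i * H 0 j)
        + G k 3 * (H 0 i * H 2 j + H 2 i * H 0 j + H 1 i * H 1 j) := by
    simp only [gAct, ← hG, ← hH, Matrix.mulVec_single_one]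
    simp [mul, mu463, Matrix.mulVec, dotProduct, Fin.sum_univ_four,
      -mul_eq_mul_left_iff]
    ring
  clear_value G H
  clear hG hH
  have hd (i : Fin 4) : G i i ≠ 0 ∧ H i i ≠ 0 := by
    rw [← mul_ne_zero_iff]
    have h1 : (G * H) i i = 1 := by rw [hGH, Matrix.one_apply_eq]
    rw [Matrix.mul_apply, Finset.sum_eq_single i] at h1
    · simp [h1]
    · intro j _ hj
      rcases lt_or_gt_of_ne hj with hj | hj
      · rw [hHl j i hj, mul_zero]
      · rw [hg i j hj, zero_mul]
    · simp
  have g12 : G 1 2 = 0 := hg _ _ (by decide)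
  have g13 : G 1 3 = 0 := hg _ _ (by decide)
  have g23 : G 2 3 = 0 := hg _ _ (by decide)
  have h01 : H 0 1 = 0 := hHl _ _ (by decide)
  have h02 : H 0 2 = 0 := hHl _ _ (by decide)
  have h12 : H 1 2 = 0 := hHl _ _ (by decide)
  refine ⟨fun i j k => ?_, fun i j k hk => ?_, ?_, ?_, ?_, ?_⟩
  · simp only [key]; ring
  · have g02 : G 0 2 = 0 := hg _ _ (by decide)
    have g03 : G 0 3 = 0 := hg _ _ (by decide)
    have h03 : H 0 3 = 0 := hHl _ _ (by decide)
    have h13 : H 1 3 = 0 := hHl _ _ (by decide)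
    have h23 : H 2 3 = 0 := hHl _ _ (by decide)
    rw [key]
    fin_cases i <;> fin_cases j <;> fin_cases k <;> simp at hk <;>
      simp [*]
  · simp [key, g12, g13]
  · simp [key, g23, h01, hd]
  · simp [key, h02, h12, hd]
  · simp [key, h01, hd]

end Vn

/-- the orbit of `𝔄_{4,63}` is not distinguished: it contains no soliton. -/
theorem stmt19 : ∀ ν ∈ Vn.orbit mu463, ¬ Vn.IsSoliton ν := by
  rintro _ ⟨g, rfl⟩ hν
  obtain ⟨k, hk, hkg⟩ := Vn.exists_unitary_mul_lowerTriangular g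
  obtain ⟨c, hc⟩ := hν.exists_gAct_of_unitary k hk
  rw [← Vn.gAct_mul] at hc
  obtain ⟨hs, hz, h001, h012, h023, h113⟩ := Vn.gAct_mu463_filtered hkg
  exact Vn.glAct_Mmat_ne_smul_of_filtered hs hz h001 h012 h023 h113 c hc
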